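/- A₁ is ≤ʳ_c-minimal among non-pot(Π⁰₁) Borel sets: A₁ is not pot(Π⁰₁), and for every Borel set A ⊆ X×Y (X, Y Polish) which is not pot(Π⁰₁), A ≤ʳ_c A₁ implies A₁ ≤ʳ_c A. -/

import Mathlib

open Set Topology

abbrev Cantor : Type := ℕ → Bool

/-- `A ⊆ X × Y` is potentially closed (`pot(Π⁰₁)`): there are finer Polish topologies on `X`
and `Y` making `A` closed in the product. -/
def PotClosed {X Y : Type} (tX : TopologicalSpace X) (tY : TopologicalSpace Y)
    (A : Set (X × Y)) : Prop :=
  ∃ (σ : TopologicalSpace X) (τ : TopologicalSpace Y),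
    σ ≤ tX ∧ τ ≤ tY ∧ @PolishSpace X σ ∧ @PolishSpace Y τ ∧
    @IsClosed (X × Y) (@instTopologicalSpaceProd X Y σ τ) A

/-- Membership in the class `D₂(Σ⁰₁)`: difference of two open sets. -/
def D2Sigma01 {Z : Type} (t : TopologicalSpace Z) (A : Set Z) : Prop :=
  ∃ U V : Set Z, @IsOpen Z t U ∧ @IsOpen Z t V ∧ A = U \ V

/-- The rectangular continuous reducibility `A ≤ʳ_c A'`. -/
def RedRC {X Y X' Y' : Type} (tX : TopologicalSpace X) (tY : TopologicalSpace Y)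
    (tX' : TopologicalSpace X') (tY' : TopologicalSpace Y')
    (A : Set (X × Y)) (A' : Set (X' × Y')) : Prop :=
  ∃ (u : X → X') (v : Y → Y'),
    @Continuous X X' tX tX' u ∧ @Continuous Y Y' tY tY' v ∧
    A = (fun p => (u p.1, v p.2)) ⁻¹' A'

/-- `≤ʳ_c` on subsets of `Cantor × Cantor` with the standard topology. -/
def RedC2 (A A' : Set (Cantor × Cantor)) : Prop :=
  RedRC inferInstance inferInstance inferInstance inferInstance A A'

/-- `A` is `≤ʳ_c`-minimal among non-potentially closed Borel sets. -/
def MinNonPotClosed {X Y : Type} (tX : TopologicalSpace X) (tY : TopologicalSpace Y)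
    (A : Set (X × Y)) : Prop :=
  ¬ PotClosed tX tY A ∧
  ∀ (X' Y' : Type) (tX' : TopologicalSpace X') (tY' : TopologicalSpace Y'),
    @PolishSpace X' tX' → @PolishSpace Y' tY' →
    ∀ A' : Set (X' × Y'),
      @MeasurableSet (X' × Y') (@borel (X' × Y') (@instTopologicalSpaceProd X' Y' tX' tY')) A' →
      ¬ PotClosed tX' tY' A' →
      RedRC tX' tY' tX tY A' A → RedRC tX tY tX' tY' A A'

/-- The Borel reducibility `A ≤_B A'` for square sets. -/
def RedB {Z Z' : Type} (tZ : TopologicalSpace Z) (tZ' : TopologicalSpace Z')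
    (A : Set (Z × Z)) (A' : Set (Z' × Z'))  : Prop :=
  ∃ u : Z → Z', @Measurable Z Z' (@borel Z tZ) (@borel Z' tZ') u ∧
    A = (fun p => (u p.1, u p.2)) ⁻¹' A'

/-- `A` is `≤_B`-minimal among non-potentially closed Borel (square) sets. -/
def MinBNonPotClosed {Z : Type} (tZ : TopologicalSpace Z) (A : Set (Z × Z)) : Prop :=
  ¬ PotClosed tZ tZ A ∧
  ∀ (Z' : Type) (tZ' : TopologicalSpace Z'), @PolishSpace Z' tZ' →
    ∀ A' : Set (Z' × Z'),
      @MeasurableSet (Z' × Z') (@borel (Z' × Z') (@instTopologicalSpaceProd Z' Z' tZ' tZ')) A' →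
      ¬ PotClosed tZ' tZ' A' →
      RedB tZ' tZ A' A → RedB tZ tZ' A A'

/-- The graph of the partial function `f` with domain `D`. -/
def graphRel {X : Type} (D : Set X) (f : X → X) : Set (X × X) :=
  {p | p.1 ∈ D ∧ p.2 = f p.1}

/-- `A^f := ⋃ₙ Graph(fₙ)`. -/
def unionGraphs {X : Type} (D : ℕ → Set X) (f : ℕ → X → X) : Set (X × X) :=
  ⋃ n, graphRel (D n) (f n)

/-- `f` restricted to `D` is a partial homeomorphism with clopen domain and clopen range. -/
def IsPartialHomeo {X : Type} (t : TopologicalSpace X) (D : Set X) (f : X → X) : Prop :=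
  @IsClopen X t D ∧ @IsClopen X t (f '' D) ∧ @ContinuousOn X X t t f D ∧
    ∃ g : X → X, @ContinuousOn X X t t g (f '' D) ∧ ∀ x ∈ D, g (f x) = x

/-- A converging situation: a nonempty zero-dimensional perfect Polish space together with
partial homeomorphisms with clopen domains and ranges such that
`Δ(X) = closure(A^f) \ A^f`. -/
def ConvSit (X : Type) (t : TopologicalSpace X) (D : ℕ → Set X) (f : ℕ → X → X) : Prop :=
  Nonempty X ∧ @PolishSpace X t ∧
  @TopologicalSpace.IsTopologicalBasis X t {s : Set X | @IsClopen X t s} ∧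
  @Perfect X t Set.univ ∧
  (∀ n, IsPartialHomeo t (D n) (f n)) ∧
  Set.diagonal X =
    @closure (X × X) (@instTopologicalSpaceProd X X t t) (unionGraphs D f) \ unionGraphs D f

/-- The domain of the restriction `f^B` of the partial map `(D, f)` to a subset `B`. -/
def subD {X : Type} (B : Set X) (D : Set X) (f : X → X) : Set ↥B :=
  {x | (x : X) ∈ D ∧ f (x : X) ∈ B}

/-- The restriction `f^B` of `f` to `B`, as a map of the subtype (junk value outside). -/
noncomputable def subF {X : Type} (B : Set X) (f : X → X) : ↥B → ↥B :=
  fun x =>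
    letI := Classical.dec (f (x : X) ∈ B)
    if h : f (x : X) ∈ B then ⟨f (x : X), h⟩ else x

/-- `A^f ∩ B²`, viewed on the subtype `B`: the union of the graphs of the `f^B_n`'s. -/
def restrGraphs {X : Type} (B : Set X) (D : ℕ → Set X) (f : ℕ → X → X) : Set (↥B × ↥B) :=
  unionGraphs (fun n => subD B (D n) (f n)) (fun n => subF B (f n))

/-- The subspace topology on `B` induced by a topology `t` on `X`. -/
def subTop {X : Type} (t : TopologicalSpace X) (B : Set X) : TopologicalSpace ↥B :=
  @TopologicalSpace.induced ↥B X Subtype.val t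

/-- The natural bijection `ψ : ω → 2^{<ω}` (enumeration by length, then lexicographically):
`ψ(n)` is the binary expansion of `n+1` with its leading one removed. -/
def psiSeq (n : ℕ) : List Bool := ((n + 1).bits.dropLast).reverse

/-- `s_n := ψ(n)0^{n-|ψ(n)|}`, a dense sequence with `|s_n| = n`. -/
def sSeq (n : ℕ) : List Bool := psiSeq n ++ List.replicate (n - (psiSeq n).length) false

/-- The concatenation `sγ` of a finite sequence `s` with `γ ∈ 2^ω`. -/
def catSeq (s : List Bool) (γ : Cantor) : Cantor :=
  fun i => if h : i < s.length then s.get ⟨i, h⟩ else γ (i - s.length)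

/-- `A₁ := {(s_n0γ, s_n1γ) : n ∈ ω, γ ∈ 2^ω}`. -/
def A1 : Set (Cantor × Cantor) :=
  {p | ∃ (n : ℕ) (γ : Cantor),
    p.1 = catSeq (sSeq n ++ [false]) γ ∧ p.2 = catSeq (sSeq n ++ [true]) γ}

/-- `Card(x↾n)`: the number of ones among the first `n` coordinates of `x`. -/
def cardOnes (x : Cantor) (n : ℕ) : ℕ := ∑ i ∈ Finset.range n, (if x i then 1 else 0)

/-- The domain of `f^S_n`: sequences vanishing at `n` whose first `n` coordinates contain a
number of ones belonging to `S`. -/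
def DSdom (S : Set ℕ) (n : ℕ) : Set Cantor := {x | x n = false ∧ cardOnes x n ∈ S}

/-- `f^S_n (s0γ) := s1γ`: flip the `n`-th coordinate to one. -/
def fSfun (n : ℕ) : Cantor → Cantor := fun x => Function.update x n true

/-- `A^S := {(s0γ, s1γ) : s ∈ 2^{<ω}, Card(s) ∈ S, γ ∈ 2^ω} = ⋃ₙ Graph(f^S_n)`. -/
def ASet (S : Set ℕ) : Set (Cantor × Cantor) := unionGraphs (DSdom S) fSfun

/-- Condition (M) on `S ⊆ ω`. -/
def CondM (S : Set ℕ) : Prop :=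
  ∀ p : ℕ, ∃ k : ℕ, ∀ q : ℕ, ∃ c : ℕ, q ≤ c ∧ c ≤ q + k ∧
    (fun m => c + m) '' (S ∩ Set.Iic p) = S ∩ Set.Icc c (c + p)

/-- Condition (H) on `S ⊆ ω`. -/
def CondH (S : Set ℕ) : Prop :=
  ∀ C : Set Cantor, @MeasurableSet Cantor (borel Cantor) C →
    ∀ σ : TopologicalSpace ↥C, σ ≤ subTop inferInstance C →
      ConvSit ↥C σ (fun n => subD C (DSdom S n) (fSfun n)) (fun n => subF C (fSfun n)) →
      ∀ l p : ℕ, ∃ n : ℕ, l ≤ n ∧ ∃ γ : ↥C, γ ∈ subD C (DSdom S n) (fSfun n) ∧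
        (fun m => cardOnes (γ : Cantor) n + m) '' (S ∩ Set.Iic p) =
          S ∩ Set.Icc (cardOnes (γ : Cantor) n) (cardOnes (γ : Cantor) n + p)

/-- Condition (⊥) on a pair `(S, S')`. -/
def CondPerp (S S' : Set ℕ) : Prop :=
  ∃ p : ℕ, ∀ c : ℕ, (fun m => c + m) '' (S ∩ Set.Iic p) ≠ S' ∩ Set.Icc c (c + p)

/-- Condition (⊥⁻¹) on a pair `(S, S')` (stated in `ℤ` to handle subtraction). -/
def CondPerpInv (S S' : Set ℕ) : Prop :=
  ∃ p : ℕ, ∀ c : ℕ,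
    (fun m : ℕ => (c : ℤ) - (m : ℤ)) '' (S ∩ Set.Iic p) ≠
      ((fun n : ℕ => (n : ℤ)) '' S') ∩ Set.Icc ((c : ℤ) - (p : ℤ)) (c : ℤ)

/-- `A⁻¹ := {(y,x) : (x,y) ∈ A}`. -/
def invRel {X : Type} (A : Set (X × X)) : Set (X × X) := {p | (p.2, p.1) ∈ A}

/-- `γ_α`: `γ_α(4n+2ε) = ε` and `γ_α(2n+1) = α(n)`. -/
def gammaSeq (α : Cantor) (k : ℕ) : Bool :=
  if k % 2 = 1 then α (k / 2) else decide (k % 4 = 2)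

/-- `β_α(i) := γ_α((i)₀)` where `(i)₀ = max {m : 2^m ∣ i+1}`, with values in `{0,1} ⊆ ω`. -/
def betaSeq (α : Cantor) (i : ℕ) : ℕ :=
  if gammaSeq α ((i + 1).factorization 2) then 1 else 0

/-- `S_β := {Σ_{i<l} (1 + β(i)) : l ∈ ω}`. -/
def Sbeta (β : ℕ → ℕ) : Set ℕ :=
  {m | ∃ l : ℕ, m = ∑ i ∈ Finset.range l, (1 + β i)}

/-- `s_n` as a function `ℕ → Bool` (with junk value `false` beyond `n`). -/
def sSeqFn (n : ℕ) (i : ℕ) : Bool := (sSeq n).getD i false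

/-- The domain of `f¹_n` (direction `d = true`) or of `(f¹_n)⁻¹` (direction `d = false`):
`x` extends `s_n` and `x(n) = !d`. -/
def step1Dom (n : ℕ) (d : Bool) : Set Cantor :=
  {x | (∀ i, i < n → x i = sSeqFn n i) ∧ x n = !d}

/-- `f¹_n` (if `d = true`) or its inverse (if `d = false`): set the `n`-th coordinate to `d`. -/
def step1Fun (n : ℕ) (d : Bool) : Cantor → Cantor := fun x => Function.update x n d

/-- Domain of `fₙ` (direction `d = true`) or of `fₙ⁻¹` (direction `d = false`). -/
def stepDom {X : Type} (D : ℕ → Set X) (f : ℕ → X → X) (n : ℕ) (d : Bool) : Set X :=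
  if d then D n else f n '' D n

/-- `fₙ` (direction `d = true`) or its inverse `gₙ` (direction `d = false`). -/
def stepFun {X : Type} (f g : ℕ → X → X) (n : ℕ) (d : Bool) : X → X :=
  if d then f n else g n

/-- An acyclic situation (Definition 26), with `g n` the inverse of `f n`. -/
def AcyclicSit (X : Type) (t : TopologicalSpace X) (D : ℕ → Set X) (f g : ℕ → X → X) : Prop :=
  Nonempty X ∧ @PolishSpace X t ∧
  @TopologicalSpace.IsTopologicalBasis X t {s : Set X | @IsClopen X t s} ∧
  @Perfect X t Set.univ ∧
  (∀ n, IsPartialHomeo t (D n) (f n)) ∧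
  (∀ n, ∀ x ∈ D n, g n (f n x) = x) ∧
  Set.diagonal X ⊆
    @closure (X × X) (@instTopologicalSpaceProd X X t t) (unionGraphs D f) \ unionGraphs D f ∧
  (∀ m : ℕ, 1 ≤ m → ∀ (v : ℕ → ℕ) (ε : ℕ → Bool),
    (∀ i, i + 1 < m → v i ≠ v (i + 1) ∨ ε i = ε (i + 1)) →
    ∀ U : Set X, @IsClopen X t U → U.Nonempty →
      ∃ V : Set X, @IsClopen X t V ∧ V.Nonempty ∧ V ⊆ U ∧
        ∀ x ∈ V, ∀ w : ℕ → X, w 0 = x →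
          (∀ i, i < m → w i ∈ stepDom D f (v i) (ε i) ∧
            w (i + 1) = stepFun f g (v i) (ε i) (w i)) →
          w m ∉ V)

/-- The relation `ℜ_Θ` on `2^{<ω}`: `e ℜ_Θ e'` iff `e = e'` or
`(e, e') = (θ_n0w, θ_n1w)` for some `n` and `w`. -/
def RTheta (θ : ℕ → List Bool) (e e' : List Bool) : Prop :=
  e = e' ∨ ∃ (n : ℕ) (w : List Bool), e = θ n ++ false :: w ∧ e' = θ n ++ true :: w

/-- The symmetrization `s(ℜ_Θ)`. -/
def sRTheta (θ : ℕ → List Bool) (e e' : List Bool) : Prop :=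
  RTheta θ e e' ∨ RTheta θ e' e

open MeasureTheory Filter

instance : PolishSpace Bool :=
  haveI : TopologicalSpace.IsCompletelyMetrizableSpace Bool := inferInstance
  {}

instance : PolishSpace Cantor := inferInstanceAs (PolishSpace (ℕ → Bool))

theorem length_psiSeq_le (n : ℕ) : (psiSeq n).length ≤ n := by
  have h : (n + 1).size ≤ n + 1 := Nat.size_le.2 Nat.lt_two_pow_self
  simp only [psiSeq, List.length_reverse, List.length_dropLast, Nat.size_eq_bits_len]
  omega

theorem length_sSeq (n : ℕ) : (sSeq n).length = n := by
  have := length_psiSeq_le n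
  simp [sSeq]
  omega

theorem exists_bits_eq_append_true (u : List Bool) :
    ∃ N : ℕ, 2 ^ u.length ≤ N ∧ N.bits = u ++ [true] := by
  induction u with
  | nil => exact ⟨1, by simp, by simp⟩
  | cons b u ih =>
    obtain ⟨N, hN, hb⟩ := ih
    have hpos : 0 < N := lt_of_lt_of_le (by positivity) hN
    refine ⟨Nat.bit b N, ?_, ?_⟩
    · simp only [List.length_cons, pow_succ, Nat.bit_val]
      omega
    · rw [Nat.bits_append_bit N b (fun h => absurd h hpos.ne'), hb, List.cons_append]

theorem exists_psiSeq_eq (t : List Bool) : ∃ n, t.length ≤ n ∧ psiSeq n = t := by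
  obtain ⟨N, hN, hb⟩ := exists_bits_eq_append_true t.reverse
  rw [List.length_reverse] at hN
  have hlt : t.length < 2 ^ t.length := Nat.lt_two_pow_self
  refine ⟨N - 1, by omega, ?_⟩
  rw [psiSeq, Nat.sub_add_cancel (by omega), hb]
  simp

/-- The sequence `sSeq` is dense. -/
theorem exists_sSeqFn_eq (x : Cantor) (L : ℕ) : ∃ n, L ≤ n ∧ ∀ i < L, sSeqFn n i = x i := by
  obtain ⟨n, hn, hp⟩ := exists_psiSeq_eq ((List.range L).map x)
  refine ⟨n, by simpa using hn, fun i hi => ?_⟩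
  simp [sSeqFn, sSeq, hp, List.getD_eq_getElem?_getD, List.getElem?_append, hi]

theorem catSeq_sSeq (n : ℕ) (b : Bool) (γ : Cantor) (i : ℕ) :
    catSeq (sSeq n ++ [b]) γ i =
      if i < n then sSeqFn n i else if i = n then b else γ (i - (n + 1)) := by
  have hl := length_sSeq n
  rcases lt_trichotomy i n with h | h | h
  · simp [catSeq, sSeqFn, hl, h, h.trans (Nat.lt_succ_self n)]
  · subst h
    simp [catSeq, hl]
  · simp [catSeq, hl, h.ne', not_lt.2 h.le, show ¬ i < n + 1 by omega]

theorem mem_step1Dom {n : ℕ} {x : Cantor} :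
    x ∈ step1Dom n true ↔ (∀ i < n, x i = sSeqFn n i) ∧ x n = false := Iff.rfl

theorem mem_A1_iff {x y : Cantor} :
    (x, y) ∈ A1 ↔ ∃ n, x ∈ step1Dom n true ∧ y = step1Fun n true x := by
  constructor
  · rintro ⟨n, γ, hx, hy⟩
    simp only at hx hy
    refine ⟨n, ⟨fun i hi => by rw [hx, catSeq_sSeq, if_pos hi], by simp [hx, catSeq_sSeq]⟩, ?_⟩
    funext i
    by_cases h : i = n
    · subst h
      simp [hy, step1Fun, catSeq_sSeq]
    · simp [hy, hx, step1Fun, catSeq_sSeq, h]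
  · rintro ⟨n, hx, rfl⟩
    rw [mem_step1Dom] at hx
    have key : ∀ i, x i = if i < n then sSeqFn n i else if i = n then false
        else x (n + 1 + (i - (n + 1))) := by
      intro i
      split_ifs with h h'
      · exact hx.1 i h
      · rw [h', hx.2]
      · congr 1
        omega
    refine ⟨n, fun i => x (n + 1 + i), ?_, ?_⟩
    · funext i
      rw [catSeq_sSeq]
      exact key i
    · funext i
      simp only [step1Fun, catSeq_sSeq]
      by_cases h : i = n
      · subst h
        simp
      · rw [Function.update_of_ne h, key i]
        simp [h]

theorem isClopen_step1Dom (n : ℕ) : IsClopen (step1Dom n true) := by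
  have h : step1Dom n true =
      (⋂ i ∈ Finset.range n, (fun x : Cantor => x i) ⁻¹' {sSeqFn n i}) ∩
        (fun x : Cantor => x n) ⁻¹' {false} := by
    ext x
    simp [mem_step1Dom]
  rw [h]
  exact (isClopen_biInter_finset fun i _ =>
    (isClopen_discrete _).preimage (continuous_apply i)).inter
      ((isClopen_discrete _).preimage (continuous_apply n))

theorem continuous_step1Fun (n : ℕ) (d : Bool) : Continuous (step1Fun n d) :=
  continuous_id.update n continuous_const

theorem mem_A1_union_diagonal_iff {x y : Cantor} :
    (x, y) ∈ A1 ∪ diagonal Cantor ↔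
      ∀ i, x i = y i ∨ (x ∈ step1Dom i true ∧ y = step1Fun i true x) := by
  constructor
  · rintro (h | h) i
    · obtain ⟨n, hx, rfl⟩ := mem_A1_iff.1 h
      by_cases hi : i = n
      · exact Or.inr ⟨hi ▸ hx, by rw [hi]⟩
      · exact Or.inl (by simp [step1Fun, hi])
    · exact Or.inl (congrFun h i)
  · intro h
    by_cases hxy : x = y
    · exact Or.inr hxy
    · obtain ⟨i, hi⟩ := Function.ne_iff.1 hxy
      exact Or.inl (mem_A1_iff.2 ⟨i, (h i).resolve_left hi⟩)

theorem isClosed_A1_union_diagonal : IsClosed (A1 ∪ diagonal Cantor) := by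
  have h : A1 ∪ diagonal Cantor = ⋂ i, ({p : Cantor × Cantor | p.1 i = p.2 i} ∪
      (Prod.fst ⁻¹' step1Dom i true ∩ {p | p.2 = step1Fun i true p.1})) := by
    ext ⟨x, y⟩
    rw [mem_A1_union_diagonal_iff]
    simp
  rw [h]
  refine isClosed_iInter fun i => IsClosed.union ?_ (IsClosed.inter ?_ ?_)
  · exact isClosed_eq ((continuous_apply i).comp continuous_fst)
      ((continuous_apply i).comp continuous_snd)
  · exact (isClopen_step1Dom i).isClosed.preimage continuous_fst
  · exact isClosed_eq continuous_snd ((continuous_step1Fun i true).comp continuous_fst)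

theorem not_mem_A1_self (x : Cantor) : (x, x) ∉ A1 := by
  intro h
  obtain ⟨n, hx, hy⟩ := mem_A1_iff.1 h
  have := congrFun hy n
  simp [step1Fun, hx.2] at this

/-- A set of vertices without `A1`-edges. -/
def A1Independent (B : Set Cantor) : Prop :=
  ∀ x ∈ B, ∀ y ∈ B, (x, y) ∉ A1

theorem A1Independent.empty : A1Independent ∅ := fun _ hx => absurd hx (notMem_empty _)

/-- An analytic independent set is contained in a Borel independent set. -/
theorem A1Independent.exists_measurableSet_superset {D : Set Cantor} (hD : AnalyticSet D)
    (hi : A1Independent D) : ∃ E, MeasurableSet E ∧ A1Independent E ∧ D ⊆ E := by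
  have hsep : ∀ n, MeasurablySeparable D (step1Fun n true '' (D ∩ step1Dom n true)) := by
    intro n
    refine hD.measurablySeparable ?_ ?_
    · refine AnalyticSet.image_of_continuous ?_ (continuous_step1Fun n true)
      rw [inter_eq_iInter]
      refine AnalyticSet.iInter fun b => ?_
      cases b
      · exact (isClopen_step1Dom n).isClosed.analyticSet
      · exact hD
    · rw [Set.disjoint_left]
      rintro _ hy ⟨x, ⟨hx, hxn⟩, rfl⟩
      exact hi x hx _ hy (mem_A1_iff.2 ⟨n, hxn, rfl⟩)
  choose S hDS hS hSm using hsep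
  refine ⟨(⋂ n, S n) \ ⋃ n, step1Dom n true ∩ step1Fun n true ⁻¹' ⋂ n, S n, ?_, ?_, ?_⟩
  · have hB : MeasurableSet (⋂ n, S n) := MeasurableSet.iInter hSm
    exact hB.diff (MeasurableSet.iUnion fun n => (isClopen_step1Dom n).isOpen.measurableSet.inter
      ((continuous_step1Fun n true).measurable hB))
  · intro x hx y hy hxy
    obtain ⟨n, hxn, rfl⟩ := mem_A1_iff.1 hxy
    exact hx.2 (mem_iUnion.2 ⟨n, hxn, hy.1⟩)
  · intro x hx
    refine ⟨mem_iInter.2 fun n => hDS n hx, fun h => ?_⟩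
    obtain ⟨n, hxn, hy⟩ := mem_iUnion.1 h
    exact Set.disjoint_left.1 (hS n) ⟨x, ⟨hx, hxn⟩, rfl⟩ (mem_iInter.1 hy n)

/-- Flipping the `n`-th coordinate. -/
def flipCoord (n : ℕ) (x : Cantor) : Cantor := Function.update x n (!x n)

theorem flipCoord_flipCoord (n : ℕ) (x : Cantor) : flipCoord n (flipCoord n x) = x := by
  simp [flipCoord]

theorem continuous_flipCoord (n : ℕ) : Continuous (flipCoord n) :=
  continuous_id.update n ((continuous_of_discreteTopology (f := not)).comp (continuous_apply n))

/-- The homeomorphism flipping the `n`-th coordinate. -/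
def flipHomeo (n : ℕ) : Cantor ≃ₜ Cantor where
  toFun := flipCoord n
  invFun := flipCoord n
  left_inv := flipCoord_flipCoord n
  right_inv := flipCoord_flipCoord n
  continuous_toFun := continuous_flipCoord n
  continuous_invFun := continuous_flipCoord n

theorem exists_cylinder_subset {O : Set Cantor} (hO : IsOpen O) {x : Cantor} (hx : x ∈ O) :
    ∃ L, ∀ y : Cantor, (∀ i < L, y i = x i) → y ∈ O := by
  obtain ⟨_, ⟨z, L, rfl⟩, hz, hsub⟩ :=
    (PiNat.isTopologicalBasis_cylinders (fun _ : ℕ => Bool)).exists_subset_of_mem_open hx hO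
  refine ⟨L, fun y hy => hsub ?_⟩
  rw [PiNat.mem_cylinder_iff] at hz ⊢
  intro i hi
  rw [hy i hi, hz i hi]

/-- A Borel independent set is meager. -/
theorem A1Independent.compl_mem_residual {B : Set Cantor} (hB : MeasurableSet B)
    (hi : A1Independent B) : Bᶜ ∈ residual Cantor := by
  obtain ⟨O, hO, hBO⟩ := hB.residualEq_isOpen
  rcases O.eq_empty_or_nonempty with rfl | ⟨x₀, hx₀⟩
  · filter_upwards [hBO.mem_iff] with x hx
    simpa using hx
  exfalso
  obtain ⟨L, hL⟩ := exists_cylinder_subset hO hx₀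
  obtain ⟨n, hLn, hn⟩ := exists_sSeqFn_eq x₀ L
  have hG : {x | x ∈ B ↔ x ∈ O} ∈ residual Cantor := hBO.mem_iff
  have hG' : {x | flipCoord n x ∈ B ↔ flipCoord n x ∈ O} ∈ residual Cantor :=
    tendsto_residual_of_isOpenMap (flipHomeo n).continuous (flipHomeo n).isOpenMap hG
  have hne : (step1Dom n true).Nonempty :=
    ⟨fun i => if i < n then sSeqFn n i else false, fun i hi => if_pos hi, by simp⟩
  obtain ⟨x, hxn, hx, hx'⟩ := (dense_of_mem_residual (inter_mem hG hG')).inter_open_nonempty _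
    (isClopen_step1Dom n).isOpen hne
  have hflip : flipCoord n x = step1Fun n true x := by
    simp [flipCoord, step1Fun, (mem_step1Dom.1 hxn).2]
  have hxO : x ∈ O := hL x fun i hi => by
    rw [(mem_step1Dom.1 hxn).1 i (hi.trans_le hLn), hn i hi]
  have hyO : flipCoord n x ∈ O := hL _ fun i hi => by
    rw [flipCoord, Function.update_of_ne (hi.trans_le hLn).ne,
      (mem_step1Dom.1 hxn).1 i (hi.trans_le hLn), hn i hi]
  exact hi x (hx.2 hxO) _ (hx'.2 hyO) (mem_A1_iff.2 ⟨n, hxn, hflip⟩)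

theorem exists_countable_rectangle_cover {X Y : Type*} [TopologicalSpace X] [TopologicalSpace Y]
    [SecondCountableTopology X] [SecondCountableTopology Y] {O : Set (X × Y)} (hO : IsOpen O) :
    ∃ (𝓤 : Set (Set X)) (𝓥 : Set (Set Y)), 𝓤.Countable ∧ 𝓥.Countable ∧
      (∀ U ∈ 𝓤, IsOpen U) ∧ (∀ V ∈ 𝓥, IsOpen V) ∧
      ∀ x y, (x, y) ∈ O → ∃ U ∈ 𝓤, ∃ V ∈ 𝓥, x ∈ U ∧ y ∈ V ∧ U ×ˢ V ⊆ O := by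
  have hX := TopologicalSpace.isBasis_countableBasis X
  have hY := TopologicalSpace.isBasis_countableBasis Y
  refine ⟨_, _, TopologicalSpace.countable_countableBasis X,
    TopologicalSpace.countable_countableBasis Y, fun U => hX.isOpen, fun V => hY.isOpen,
    fun x y hxy => ?_⟩
  obtain ⟨_, ⟨U, hU, V, hV, rfl⟩, hx, hsub⟩ := (hX.prod hY).exists_subset_of_mem_open hxy hO
  exact ⟨U, hU, V, hV, hx.1, hx.2, hsub⟩

theorem measurableSet_of_isOpen_finer {X : Type*} [t : TopologicalSpace X] [PolishSpace X]
    [MeasurableSpace X] [BorelSpace X] {σ : TopologicalSpace X} (hσ : σ ≤ t)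
    (hP : @PolishSpace X σ) {U : Set X} (hU : IsOpen[σ] U) : MeasurableSet U := by
  have h : MeasurableSet[@borel X t] U := by
    rw [← borel_eq_borel_of_le hP ‹_› hσ]
    exact MeasurableSpace.measurableSet_generateFrom hU
  rwa [← @BorelSpace.measurable_eq X t] at h

/-- Countably many Borel rectangles disjoint from `A1` do not cover the diagonal. -/
theorem exists_diagonal_notMem_rectangles {𝓤 𝓥 : Set (Set Cantor)} (hU : 𝓤.Countable)
    (hV : 𝓥.Countable) (hUm : ∀ U ∈ 𝓤, MeasurableSet U) (hVm : ∀ V ∈ 𝓥, MeasurableSet V) :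
    ∃ x, ∀ U ∈ 𝓤, ∀ V ∈ 𝓥, x ∈ U → x ∈ V → ¬ U ×ˢ V ⊆ A1ᶜ := by
  have hres : ∀ᶠ x in residual Cantor, ∀ U ∈ 𝓤, ∀ V ∈ 𝓥, x ∈ U → x ∈ V → ¬ U ×ˢ V ⊆ A1ᶜ := by
    refine (eventually_countable_ball hU).2 fun U hU' => (eventually_countable_ball hV).2
      fun V hV' => ?_
    by_cases hsub : U ×ˢ V ⊆ A1ᶜ
    · have hi : A1Independent (U ∩ V) := fun y hy z hz hyz => hsub (mk_mem_prod hy.1 hz.2) hyz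
      filter_upwards [hi.compl_mem_residual ((hUm U hU').inter (hVm V hV'))] with x hx h1 h2
      exact absurd ⟨h1, h2⟩ hx
    · exact Eventually.of_forall fun x _ _ => hsub
  exact (dense_of_mem_residual hres).nonempty

theorem not_potClosed_A1 : ¬ PotClosed inferInstance inferInstance A1 := by
  rintro ⟨σ, τ, hσ, hτ, hσP, hτP, hcl⟩
  obtain ⟨𝓤, 𝓥, hU, hV, hUo, hVo, hcov⟩ := @exists_countable_rectangle_cover Cantor Cantor σ τ
    _ _ _ hcl.isOpen_compl
  obtain ⟨x, hx⟩ := exists_diagonal_notMem_rectangles hU hV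
    (fun U hU' => @measurableSet_of_isOpen_finer Cantor Pi.topologicalSpace _ _ _ σ hσ hσP U
      (hUo U hU'))
    (fun V hV' => @measurableSet_of_isOpen_finer Cantor Pi.topologicalSpace _ _ _ τ hτ hτP V
      (hVo V hV'))
  obtain ⟨U, hU', V, hV', hxU, hxV, hsub⟩ := hcov x x (not_mem_A1_self x)
  exact hx U hU' V hV' hxU hxV hsub

theorem exists_finer_polishSpace_isOpen {X : Type*} [t : TopologicalSpace X] [PolishSpace X]
    {𝓔 : Set (Set X)} (hc : 𝓔.Countable) (hm : ∀ E ∈ 𝓔, MeasurableSet[borel X] E) :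
    ∃ σ : TopologicalSpace X, σ ≤ t ∧ @PolishSpace X σ ∧ ∀ E ∈ 𝓔, IsOpen[σ] E := by
  have : Countable 𝓔 := hc
  let : MeasurableSpace X := borel X
  have : BorelSpace X := ⟨rfl⟩
  have h : ∀ E : 𝓔, PolishSpace.IsClopenable (E : Set X) := fun E => (hm E E.2).isClopenable
  choose m hmt hmP _ hmo using h
  obtain ⟨σ, hσm, hσt, hσP⟩ := PolishSpace.exists_polishSpace_forall_le m hmt hmP
  exact ⟨σ, hσt, hσP, fun E hE => hσm ⟨E, hE⟩ _ (hmo ⟨E, hE⟩)⟩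

theorem isClosed_preimage_of_rectangles {X Y : Type*} [TopologicalSpace X] [TopologicalSpace Y]
    {u : X → Cantor} {v : Y → Cantor} (hu : Continuous u) (hv : Continuous v)
    {𝓔 : Set (Set Cantor)} (hi : ∀ E ∈ 𝓔, A1Independent E)
    (huo : ∀ E ∈ 𝓔, IsOpen (u ⁻¹' E)) (hvo : ∀ E ∈ 𝓔, IsOpen (v ⁻¹' E))
    (hcov : ∀ x y, u x = v y → ∃ E ∈ 𝓔, u x ∈ E) :
    IsClosed ((fun p : X × Y => (u p.1, v p.2)) ⁻¹' A1) := by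
  have h : (fun p : X × Y => (u p.1, v p.2)) ⁻¹' A1 =
      (fun p : X × Y => (u p.1, v p.2)) ⁻¹' (A1 ∪ diagonal Cantor) ∩
        ⋂ E ∈ 𝓔, ((u ⁻¹' E) ×ˢ (v ⁻¹' E))ᶜ := by
    ext ⟨x, y⟩
    simp only [mem_preimage, mem_inter_iff, mem_union, mem_diagonal_iff, mem_iInter, mem_compl_iff,
      mem_prod]
    constructor
    · exact fun h => ⟨Or.inl h, fun E hE hxy => hi E hE _ hxy.1 _ hxy.2 h⟩
    · rintro ⟨h | h, hE⟩
      · exact h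
      · obtain ⟨E, hE', hx⟩ := hcov x y h
        exact absurd ⟨hx, h ▸ hx⟩ (hE E hE')
  rw [h]
  refine (isClosed_A1_union_diagonal.preimage (by fun_prop)).inter ?_
  exact isClosed_biInter fun E hE => ((huo E hE).prod (hvo E hE)).isClosed_compl

theorem potClosed_preimage_of_cover {X Y : Type} [tX : TopologicalSpace X]
    [tY : TopologicalSpace Y] [PolishSpace X] [PolishSpace Y] {u : X → Cantor} {v : Y → Cantor}
    (hu : Continuous u) (hv : Continuous v) {𝓔 : Set (Set Cantor)} (hc : 𝓔.Countable)
    (hE : ∀ E ∈ 𝓔, MeasurableSet E ∧ A1Independent E)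
    (hcov : ∀ x y, u x = v y → ∃ E ∈ 𝓔, u x ∈ E) :
    PotClosed tX tY ((fun p : X × Y => (u p.1, v p.2)) ⁻¹' A1) := by
  have hm : ∀ {Z : Type} [TopologicalSpace Z] {f : Z → Cantor}, Continuous f →
      ∀ S ∈ (preimage f) '' 𝓔, MeasurableSet[borel Z] S := by
    rintro Z _ f hf _ ⟨E, hE', rfl⟩
    let : MeasurableSpace Z := borel Z
    have : BorelSpace Z := ⟨rfl⟩
    exact hf.measurable (hE E hE').1
  obtain ⟨σ, hσ, hσP, hσo⟩ := exists_finer_polishSpace_isOpen (hc.image _) (hm hu)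
  obtain ⟨τ, hτ, hτP, hτo⟩ := exists_finer_polishSpace_isOpen (hc.image _) (hm hv)
  refine ⟨σ, τ, hσ, hτ, hσP, hτP, ?_⟩
  exact @isClosed_preimage_of_rectangles X Y σ τ u v (continuous_le_dom hσ hu)
    (continuous_le_dom hτ hv) 𝓔 (fun E hE' => (hE E hE').2)
    (fun E hE' => hσo _ (mem_image_of_mem _ hE')) (fun E hE' => hτo _ (mem_image_of_mem _ hE')) hcov

/-- A countable family of Borel independent sets whose union cannot be usefully enlarged, for
countably many monotone tests `Z j`. -/
theorem exists_stable_family {J P : Type*} [Countable J] [TopologicalSpace P] [PolishSpace P]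
    [MeasurableSpace P] [BorelSpace P] (Z : J → Set Cantor → Set P) (hmono : ∀ j, Monotone (Z j))
    (hmeas : ∀ j V, MeasurableSet V → MeasurableSet (Z j V)) (π : J → P → Cantor)
    (hπ : ∀ j, Continuous (π j)) (hπV : ∀ j V z, z ∈ Z j V → π j z ∈ V) :
    ∃ 𝓔 : Set (Set Cantor), 𝓔.Countable ∧ (∀ E ∈ 𝓔, MeasurableSet E ∧ A1Independent E) ∧
      ∀ j, (Z j (⋃₀ 𝓔)ᶜ).Nonempty → ∃ z₀ ∈ Z j (⋃₀ 𝓔)ᶜ, ∃ z₁ ∈ Z j (⋃₀ 𝓔)ᶜ,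
        (π j z₀, π j z₁) ∈ A1 := by
  have hfam : ∀ j, ∃ 𝓔 : Set (Set Cantor),
      (𝓔.Countable ∧ ∀ E ∈ 𝓔, MeasurableSet E ∧ A1Independent E) ∧
      ((∃ 𝓕 : Set (Set Cantor), (𝓕.Countable ∧ ∀ E ∈ 𝓕, MeasurableSet E ∧ A1Independent E) ∧
        A1Independent (π j '' Z j (⋃₀ 𝓕)ᶜ)) → A1Independent (π j '' Z j (⋃₀ 𝓔)ᶜ)) := by
    intro j
    by_cases h : ∃ 𝓕 : Set (Set Cantor),
      (𝓕.Countable ∧ ∀ E ∈ 𝓕, MeasurableSet E ∧ A1Independent E) ∧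
        A1Independent (π j '' Z j (⋃₀ 𝓕)ᶜ)
    · obtain ⟨𝓕, h1, h2⟩ := h
      exact ⟨𝓕, h1, fun _ => h2⟩
    · exact ⟨∅, ⟨countable_empty, by simp⟩, fun h' => absurd h' h⟩
  choose 𝓔 h𝓔 hgood using hfam
  have hWm : MeasurableSet (⋃₀ ⋃ j, 𝓔 j)ᶜ := by
    refine (MeasurableSet.sUnion (countable_iUnion fun j => (h𝓔 j).1) fun E hE => ?_).compl
    obtain ⟨j, hj⟩ := mem_iUnion.1 hE
    exact ((h𝓔 j).2 E hj).1
  have hE' : ∀ j, ∃ E, (MeasurableSet E ∧ A1Independent E) ∧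
      (A1Independent (π j '' Z j (⋃₀ ⋃ j, 𝓔 j)ᶜ) → π j '' Z j (⋃₀ ⋃ j, 𝓔 j)ᶜ ⊆ E) := by
    intro j
    by_cases h : A1Independent (π j '' Z j (⋃₀ ⋃ j, 𝓔 j)ᶜ)
    · obtain ⟨E, h1, h2, h3⟩ := A1Independent.exists_measurableSet_superset
        ((hmeas j _ hWm).analyticSet.image_of_continuous (hπ j)) h
      exact ⟨E, ⟨h1, h2⟩, fun _ => h3⟩
    · exact ⟨∅, ⟨MeasurableSet.empty, A1Independent.empty⟩, fun h' => absurd h' h⟩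
  choose E hE hsub using hE'
  have hG : ((⋃ j, 𝓔 j) ∪ range E).Countable ∧
      ∀ F ∈ (⋃ j, 𝓔 j) ∪ range E, MeasurableSet F ∧ A1Independent F := by
    refine ⟨(countable_iUnion fun j => (h𝓔 j).1).union (countable_range E), ?_⟩
    rintro F (hF | ⟨j, rfl⟩)
    · obtain ⟨j, hj⟩ := mem_iUnion.1 hF
      exact (h𝓔 j).2 F hj
    · exact hE j
  refine ⟨_, hG.1, hG.2, fun j ⟨z, hz⟩ => ?_⟩
  by_contra! hcon
  have h1 : A1Independent (π j '' Z j (⋃₀ 𝓔 j)ᶜ) := by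
    refine hgood j ⟨_, hG, ?_⟩
    rintro _ ⟨z₀, h₀, rfl⟩ _ ⟨z₁, h₁, rfl⟩
    exact hcon z₀ h₀ z₁ h₁
  have h2 : A1Independent (π j '' Z j (⋃₀ ⋃ j, 𝓔 j)ᶜ) := by
    have hs : π j '' Z j (⋃₀ ⋃ j, 𝓔 j)ᶜ ⊆ π j '' Z j (⋃₀ 𝓔 j)ᶜ :=
      image_mono (hmono j (compl_subset_compl.2 (sUnion_subset_sUnion (subset_iUnion 𝓔 j))))
    exact fun x hx y hy => h1 x (hs hx) y (hs hy)
  have hz' : z ∈ Z j (⋃₀ ⋃ j, 𝓔 j)ᶜ :=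
    hmono j (compl_subset_compl.2 (sUnion_subset_sUnion subset_union_left)) hz
  exact hπV j _ z hz (mem_sUnion.2 ⟨E j, Or.inr (mem_range_self j),
    hsub j h2 (mem_image_of_mem _ hz')⟩)

/-- The list of the first `n` digits of `sSeqFn n`, last digit first. -/
def sRes (n : ℕ) : List Bool := PiNat.res (sSeqFn n) n

/-- `ψ` maps the binary words of length `n` (written last digit first) to vertices connected by
`A1`-edges in the same way as the words are, with the label `m k` in place of `k`. -/
def Conf : ℕ → (ℕ → ℕ) → (List Bool → Cantor) → Prop
  | 0, _, _ => True
  | n + 1, m, ψ => Conf n m (fun t => ψ (false :: t)) ∧ Conf n m (fun t => ψ (true :: t)) ∧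
      (∀ k < n, m k < m n) ∧ ψ (false :: sRes n) ∈ step1Dom (m n) true ∧
      ψ (true :: sRes n) = step1Fun (m n) true (ψ (false :: sRes n))

theorem Conf.congr {n : ℕ} {m m' : ℕ → ℕ} (h : ∀ k < n, m k = m' k) {ψ : List Bool → Cantor}
    (hc : Conf n m ψ) : Conf n m' ψ := by
  induction n generalizing ψ with
  | zero => trivial
  | succ n ih =>
    have h' : ∀ k < n, m k = m' k := fun k hk => h k (by omega)
    refine ⟨ih h' hc.1, ih h' hc.2.1, fun k hk => ?_, ?_⟩
    · rw [← h' k hk, ← h n (by omega)]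
      exact hc.2.2.1 k hk
    · rw [← h n (by omega)]
      exact hc.2.2.2

theorem isClosed_setOf_conf (n : ℕ) (m : ℕ → ℕ) : IsClosed {ψ | Conf n m ψ} := by
  induction n with
  | zero => simp [Conf]
  | succ n ih =>
    have hcons : ∀ b : Bool, Continuous fun (ψ : List Bool → Cantor) t => ψ (b :: t) :=
      fun b => continuous_pi fun t => continuous_apply _
    refine (ih.preimage (hcons false)).inter ((ih.preimage (hcons true)).inter
      (isClosed_const.inter (IsClosed.inter ?_ ?_)))
    · exact (isClopen_step1Dom (m n)).isClosed.preimage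
        (continuous_apply (A := fun _ : List Bool => Cantor) (false :: sRes n))
    · exact isClosed_eq (continuous_apply (true :: sRes n))
        ((continuous_step1Fun (m n) true).comp (continuous_apply (false :: sRes n)))

theorem Conf.apply_eq {n : ℕ} {m : ℕ → ℕ} {ψ : List Bool → Cantor} (hc : Conf n m ψ) {i : ℕ}
    (hi : ∀ k < n, i ≠ m k) (x y : Cantor) : ψ (PiNat.res x n) i = ψ (PiNat.res y n) i := by
  induction n generalizing ψ x y with
  | zero => rfl
  | succ n ih =>
    have hi' : ∀ k < n, i ≠ m k := fun k hk => hi k (by omega)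
    have key : ∀ (b : Bool) (x : Cantor), ψ (b :: PiNat.res x n) i = ψ (false :: sRes n) i := by
      rintro (_ | _) x
      · exact ih hc.1 hi' x _
      · rw [ih hc.2.1 hi' x (sSeqFn n)]
        have := congrFun hc.2.2.2.2 i
        rw [step1Fun, Function.update_of_ne (hi n (by omega))] at this
        exact this
    rw [PiNat.res_succ, PiNat.res_succ, key, key]

theorem Conf.apply_cons_sRes {n : ℕ} {m : ℕ → ℕ} {ψ : List Bool → Cantor} (hc : Conf (n + 1) m ψ)
    (b : Bool) : (∀ i < m n, ψ (b :: sRes n) i = sSeqFn (m n) i) ∧ ψ (b :: sRes n) (m n) = b := by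
  obtain ⟨h1, h2⟩ := mem_step1Dom.1 hc.2.2.2.1
  cases b
  · exact ⟨h1, h2⟩
  · rw [hc.2.2.2.2, step1Fun]
    refine ⟨fun i hi => ?_, Function.update_self ..⟩
    rw [Function.update_of_ne hi.ne]
    exact h1 i hi

theorem Conf.cons {n : ℕ} {m : ℕ → ℕ} {ψ : List Bool → Cantor} (hc : Conf (n + 1) m ψ)
    (b : Bool) : Conf n m fun t => ψ (b :: t) := by
  cases b
  exacts [hc.1, hc.2.1]

theorem Conf.apply_label {n : ℕ} {m : ℕ → ℕ} {ψ : List Bool → Cantor} (hc : Conf n m ψ) {k : ℕ}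
    (hk : k < n) (x : Cantor) : ψ (PiNat.res x n) (m k) = x k := by
  induction n generalizing ψ with
  | zero => omega
  | succ n ih =>
    rw [PiNat.res_succ]
    rcases Nat.lt_succ_iff_lt_or_eq.1 hk with hk | rfl
    · exact ih (hc.cons _) hk
    · rw [(hc.cons (x k)).apply_eq (fun j hj => (hc.2.2.1 j hj).ne') x (sSeqFn k)]
      exact (hc.apply_cons_sRes _).2

theorem Conf.apply_of_lt_label {n : ℕ} {m : ℕ → ℕ} {ψ : List Bool → Cantor} (hc : Conf n m ψ)
    {k : ℕ} (hk : k < n) {x : Cantor} (hx : ∀ j < k, x j = sSeqFn k j) {i : ℕ} (hi : i < m k) :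
    ψ (PiNat.res x n) i = sSeqFn (m k) i := by
  induction n generalizing ψ with
  | zero => omega
  | succ n ih =>
    rw [PiNat.res_succ]
    rcases Nat.lt_succ_iff_lt_or_eq.1 hk with hk | rfl
    · exact ih (hc.cons _) hk
    · have : PiNat.res x k = sRes k := PiNat.res_eq_res.2 fun {j} hj => hx j hj
      rw [this]
      exact (hc.apply_cons_sRes _).1 i hi

/-- A map on `Cantor` sharing the coordinate properties of configurations preserves and reflects
`A1`. -/
theorem mem_A1_iff_of_labels {Φ : Cantor → Cantor} {m : ℕ → ℕ} (hm : StrictMono m)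
    (h₁ : ∀ x k, Φ x (m k) = x k) (h₂ : ∀ x y i, (∀ k, i ≠ m k) → Φ x i = Φ y i)
    (h₃ : ∀ x k, (∀ j < k, x j = sSeqFn k j) → ∀ i < m k, Φ x i = sSeqFn (m k) i)
    (x y : Cantor) : (x, y) ∈ A1 ↔ (Φ x, Φ y) ∈ A1 := by
  have hinj : Function.Injective Φ := fun a b hab => by
    funext k
    rw [← h₁ a k, ← h₁ b k, hab]
  have hupd : ∀ x k, Φ (Function.update x k true) = Function.update (Φ x) (m k) true := by
    intro x k
    funext i
    by_cases hi : ∃ l, i = m l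
    · obtain ⟨l, rfl⟩ := hi
      rw [h₁]
      by_cases hl : l = k
      · subst hl
        simp
      · rw [Function.update_of_ne hl, Function.update_of_ne (hm.injective.ne hl), h₁]
    · push Not at hi
      rw [Function.update_of_ne (hi k)]
      exact h₂ _ _ i hi
  rw [mem_A1_iff, mem_A1_iff]
  constructor
  · rintro ⟨k, hx, rfl⟩
    obtain ⟨hx₁, hx₂⟩ := mem_step1Dom.1 hx
    exact ⟨m k, mem_step1Dom.2 ⟨h₃ x k hx₁, by rw [h₁, hx₂]⟩, hupd x k⟩
  · rintro ⟨l, hx, hy⟩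
    obtain ⟨hx₁, hx₂⟩ := mem_step1Dom.1 hx
    have hl : ∃ k, l = m k := by
      by_contra! hl
      have := congrFun hy l
      rw [step1Fun, Function.update_self, h₂ y x l hl, hx₂] at this
      exact absurd this (by simp)
    obtain ⟨k, rfl⟩ := hl
    refine ⟨k, mem_step1Dom.2 ⟨fun j hj => ?_, by rw [← h₁ x, hx₂]⟩, hinj ?_⟩
    · rw [← h₁ x j, hx₁ _ (hm hj), ← h₃ (sSeqFn k) k (fun _ _ => rfl) _ (hm hj), h₁]
    · rw [hy]
      exact (hupd x k).symm

/-- Every nonempty open set of configurations with vertices in `V` contains two of them whose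
distinguished vertices form an `A1`-edge. -/
def Splits {R : Type*} [TopologicalSpace R] (w : R → Cantor) (V : Set Cantor) : Prop :=
  ∀ (n : ℕ) (m : ℕ → ℕ) (O : Set (List Bool → R)), IsOpen O →
    (∃ φ ∈ O, Conf n m (w ∘ φ) ∧ ∀ t : List Bool, t.length = n → w (φ t) ∈ V) →
    ∃ φ₀ ∈ O, ∃ φ₁ ∈ O,
      (Conf n m (w ∘ φ₀) ∧ ∀ t : List Bool, t.length = n → w (φ₀ t) ∈ V) ∧
      (Conf n m (w ∘ φ₁) ∧ ∀ t : List Bool, t.length = n → w (φ₁ t) ∈ V) ∧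
      (w (φ₀ (sRes n)), w (φ₁ (sRes n))) ∈ A1

theorem exists_splits {R : Type*} [TopologicalSpace R] [PolishSpace R] {w : R → Cantor}
    (hw : Continuous w) : ∃ 𝓔 : Set (Set Cantor), 𝓔.Countable ∧
      (∀ E ∈ 𝓔, MeasurableSet E ∧ A1Independent E) ∧ Splits w (⋃₀ 𝓔)ᶜ := by
  let : MeasurableSpace (List Bool → R) := borel _
  have : BorelSpace (List Bool → R) := ⟨rfl⟩
  let B := TopologicalSpace.countableBasis (List Bool → R)
  have hB : TopologicalSpace.IsTopologicalBasis B := TopologicalSpace.isBasis_countableBasis _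
  have hBc : Countable B := (TopologicalSpace.countable_countableBasis _).to_subtype
  let Z : ℕ × List ℕ × B → Set Cantor → Set (List Bool → R) := fun j V =>
    {φ | φ ∈ (j.2.2 : Set (List Bool → R)) ∧ Conf j.1 (fun k => j.2.1.getD k 0) (w ∘ φ) ∧
      ∀ t : List Bool, t.length = j.1 → w (φ t) ∈ V}
  have hcomp : Continuous fun (φ : List Bool → R) => w ∘ φ :=
    continuous_pi fun t => hw.comp (continuous_apply t)
  obtain ⟨𝓔, hc, hE, hs⟩ := exists_stable_family Z
    (fun j V V' hV φ hφ => ⟨hφ.1, hφ.2.1, fun t ht => hV (hφ.2.2 t ht)⟩)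
    (fun j V hV => by
      have hfib : MeasurableSet
          {φ : List Bool → R | ∀ t : List Bool, t.length = j.1 → w (φ t) ∈ V} := by
        simp only [ofPred_forall]
        exact MeasurableSet.iInter fun t => MeasurableSet.iInter fun _ =>
          (hw.comp (continuous_apply t)).measurable hV
      exact (hB.isOpen j.2.2.2).measurableSet.inter
        (((isClosed_setOf_conf _ _).preimage hcomp).measurableSet.inter hfib))
    (fun j φ => w (φ (sRes j.1))) (fun j => hw.comp (continuous_apply _))
    (fun j V φ hφ => hφ.2.2 _ (PiNat.res_length _ _))
  refine ⟨𝓔, hc, hE, fun n m O hO ⟨φ, hφO, hφ, hφV⟩ => ?_⟩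
  obtain ⟨U, hUB, hφU, hUO⟩ := hB.exists_subset_of_mem_open hφO hO
  have hL : ∀ k < n, m k = ((List.range n).map m).getD k 0 := fun k hk => by
    simp [List.getD_eq_getElem?_getD, hk]
  obtain ⟨φ₀, h₀, φ₁, h₁, h⟩ := hs (n, (List.range n).map m, ⟨U, hUB⟩)
    ⟨φ, hφU, hφ.congr hL, hφV⟩
  exact ⟨φ₀, hUO h₀.1, φ₁, hUO h₁.1, ⟨h₀.2.1.congr fun k hk => (hL k hk).symm, h₀.2.2⟩,
    ⟨h₁.2.1.congr fun k hk => (hL k hk).symm, h₁.2.2⟩, h⟩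

theorem Splits.exists_succ {R : Type*} [MetricSpace R] {w : R → Cantor} (hw : Continuous w)
    {V : Set Cantor} (hV : Splits w V) {n : ℕ} {φ : List Bool → R} {m : ℕ → ℕ}
    (h : Conf n m (w ∘ φ) ∧ ∀ t : List Bool, t.length = n → w (φ t) ∈ V) {ε : ℝ} (hε : 0 < ε) :
    ∃ (φ' : List Bool → R) (m' : ℕ → ℕ),
      (Conf (n + 1) m' (w ∘ φ') ∧ ∀ t : List Bool, t.length = n + 1 → w (φ' t) ∈ V) ∧
      (∀ k < n, m' k = m k) ∧
      ∀ (b : Bool) (t : List Bool), t.length = n → dist (φ' (b :: t)) (φ t) < ε := by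
  obtain ⟨M, hM⟩ : ∃ M, ∀ k < n, m k < M :=
    ⟨∑ k ∈ Finset.range n, (m k + 1), fun k hk => Nat.lt_of_succ_le
      (Finset.single_le_sum (f := fun k => m k + 1) (fun _ _ => Nat.zero_le _)
        (Finset.mem_range.2 hk))⟩
  let O : Set (List Bool → R) :=
    (⋂ t ∈ {t : List Bool | t.length = n}, {φ' | dist (φ' t) (φ t) < ε}) ∩
      ⋂ i ∈ Set.Iio M, {φ' | w (φ' (sRes n)) i = w (φ (sRes n)) i}
  have hO : IsOpen O := by
    refine ((List.finite_length_eq Bool n).isOpen_biInter fun t _ => ?_).inter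
      ((Set.finite_Iio M).isOpen_biInter fun i _ => ?_)
    · exact isOpen_lt ((continuous_apply t).dist continuous_const) continuous_const
    · exact (isOpen_discrete {w (φ (sRes n)) i}).preimage
        ((continuous_apply i).comp (hw.comp (continuous_apply (sRes n))))
  have hφO : φ ∈ O := by simp [O, hε]
  obtain ⟨φ₀, h₀, φ₁, h₁, ⟨hc₀, hV₀⟩, ⟨hc₁, hV₁⟩, hA⟩ := hV n m O hO ⟨φ, hφO, h⟩
  simp only [O, mem_inter_iff, mem_iInter, mem_ofPred_eq, mem_Iio] at h₀ h₁
  obtain ⟨μ, hμ, hμ'⟩ := mem_A1_iff.1 hA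
  have hMμ : M ≤ μ := by
    by_contra! hlt
    have h2 := congrFun hμ' μ
    rw [step1Fun, Function.update_self, h₁.2 μ hlt, ← h₀.2 μ hlt, (mem_step1Dom.1 hμ).2] at h2
    exact absurd h2 (by simp)
  have hm' : ∀ k < n, m k = Function.update m n μ k := fun k hk => by
    rw [Function.update_of_ne hk.ne]
  refine ⟨fun t => match t with
    | [] => φ []
    | false :: t => φ₀ t
    | true :: t => φ₁ t, Function.update m n μ, ⟨⟨hc₀.congr hm', hc₁.congr hm', ?_, ?_, ?_⟩, ?_⟩,
    fun k hk => (hm' k hk).symm, ?_⟩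
  · intro k hk
    rw [← hm' k hk, Function.update_self]
    exact (hM k hk).trans_le hMμ
  · rw [Function.update_self]
    exact hμ
  · rw [Function.update_self]
    exact hμ'
  · rintro (_ | ⟨_ | _, t⟩) ht
    · simp at ht
    · exact hV₀ t (by simpa using ht)
    · exact hV₁ t (by simpa using ht)
  · rintro (_ | _) t ht
    · exact h₀.1 t ht
    · exact h₁.1 t ht

theorem Splits.exists_seq {R : Type*} [MetricSpace R] {w : R → Cantor} (hw : Continuous w)
    {V : Set Cantor} (hV : Splits w V) {r : R} (hr : w r ∈ V) {ε : ℕ → ℝ} (hε : ∀ n, 0 < ε n) :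
    ∃ (φ : ℕ → List Bool → R) (m : ℕ → ℕ), ∀ n, Conf n m (w ∘ φ n) ∧
      ∀ (b : Bool) (t : List Bool), t.length = n → dist (φ (n + 1) (b :: t)) (φ n t) < ε n := by
  let S : ℕ → Type _ := fun n => {p : (List Bool → R) × (ℕ → ℕ) //
    Conf n p.2 (w ∘ p.1) ∧ ∀ t : List Bool, t.length = n → w (p.1 t) ∈ V}
  have hstep : ∀ n (p : S n), ∃ q : S (n + 1), (∀ k < n, q.1.2 k = p.1.2 k) ∧
      ∀ (b : Bool) (t : List Bool), t.length = n → dist (q.1.1 (b :: t)) (p.1.1 t) < ε n := by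
    rintro n ⟨⟨φ, m⟩, hp⟩
    obtain ⟨φ', m', h1, h2, h3⟩ := hV.exists_succ hw hp (hε n)
    exact ⟨⟨(φ', m'), h1⟩, h2, h3⟩
  choose next hnext₁ hnext₂ using hstep
  let st : ∀ n, S n := fun n =>
    Nat.rec (motive := S) ⟨(fun _ => r, fun _ => 0), trivial, fun _ _ => hr⟩ next n
  have hlabel : ∀ n k, k < n → (st n).1.2 k = (st (k + 1)).1.2 k := by
    intro n k hk
    induction n, hk using Nat.le_induction with
    | base => rfl
    | succ n hn ih => exact (hnext₁ n (st n) k hn).trans ih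
  exact ⟨fun n => (st n).1.1, fun k => (st (k + 1)).1.2 k, fun n =>
    ⟨(st n).2.1.congr fun k hk => hlabel n k hk, hnext₂ n (st n)⟩⟩

theorem continuous_res_comp {R : Type*} [TopologicalSpace R] (n : ℕ) (f : List Bool → R) :
    Continuous fun x : Cantor => f (PiNat.res x n) := by
  refine IsLocallyConstant.continuous ((IsLocallyConstant.iff_exists_open _).2 fun x => ?_)
  refine ⟨PiNat.cylinder x n, PiNat.isOpen_cylinder _ x n, PiNat.self_mem_cylinder x n, ?_⟩
  intro y hy
  rw [PiNat.cylinder_eq_res] at hy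
  exact congrArg f hy

theorem Splits.exists_continuous_reduction {R : Type*} [TopologicalSpace R] [PolishSpace R]
    {w : R → Cantor} (hw : Continuous w) {V : Set Cantor} (hV : Splits w V) {r : R}
    (hr : w r ∈ V) : ∃ H : Cantor → R, Continuous H ∧
      ∀ x y, (x, y) ∈ A1 ↔ (w (H x), w (H y)) ∈ A1 := by
  let := TopologicalSpace.upgradeIsCompletelyMetrizable R
  obtain ⟨φ, m, h⟩ := hV.exists_seq hw hr (ε := fun n => 1 / 2 / 2 ^ n) (fun n => by positivity)
  have hdist : ∀ (x : Cantor) n,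
      dist (φ n (PiNat.res x n)) (φ (n + 1) (PiNat.res x (n + 1))) ≤ 1 / 2 / 2 ^ n := fun x n => by
    rw [dist_comm, PiNat.res_succ]
    exact ((h n).2 _ _ (PiNat.res_length x n)).le
  choose H hH using fun x : Cantor =>
    cauchySeq_tendsto_of_complete (cauchySeq_of_le_geometric_two (hdist x))
  have hcont : Continuous H := by
    have hu : TendstoUniformly (fun n (x : Cantor) => φ n (PiNat.res x n)) H atTop := by
      rw [Metric.tendstoUniformly_iff]
      intro ε hε
      have h0 : Tendsto (fun n : ℕ => (1 : ℝ) / 2 ^ n) atTop (𝓝 0) := by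
        simpa using tendsto_pow_atTop_nhds_zero_of_lt_one (r := (1 / 2 : ℝ)) (by norm_num)
          (by norm_num)
      filter_upwards [h0.eventually_lt_const hε] with n hn x
      rw [dist_comm]
      exact (dist_le_of_le_geometric_two_of_tendsto (hdist x) (hH x) n).trans_lt hn
    exact hu.continuous (Frequently.of_forall fun n => continuous_res_comp n (φ n))
  have hev : ∀ x i, ∀ᶠ n in atTop, w (H x) i = w (φ n (PiNat.res x n)) i := fun x i => by
    have ht : Tendsto (fun n => w (φ n (PiNat.res x n)) i) atTop (𝓝 (w (H x) i)) :=
      (((continuous_apply i).comp hw).tendsto (H x)).comp (hH x)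
    rw [nhds_discrete, tendsto_pure] at ht
    exact ht.mono fun n hn => hn.symm
  have hm : StrictMono m := strictMono_nat_of_lt_succ fun n =>
    (h (n + 2)).1.2.2.1 n (Nat.lt_succ_self n)
  refine ⟨H, hcont, mem_A1_iff_of_labels (Φ := fun x => w (H x)) hm ?_ ?_ ?_⟩
  · intro x k
    obtain ⟨n, hn, hk⟩ := ((hev x (m k)).and (eventually_gt_atTop k)).exists
    exact hn.trans ((h n).1.apply_label hk x)
  · intro x y i hi
    obtain ⟨n, hx, hy⟩ := ((hev x i).and (hev y i)).exists
    exact hx.trans (((h n).1.apply_eq (fun k _ => hi k) x y).trans hy.symm)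
  · intro x k hx i hi
    obtain ⟨n, hn, hk⟩ := ((hev x i).and (eventually_gt_atTop k)).exists
    exact hn.trans ((h n).1.apply_of_lt_label hk hx hi)

theorem stmt19 : MinNonPotClosed inferInstance inferInstance A1 := by
  refine ⟨not_potClosed_A1, ?_⟩
  rintro X Y tX tY hX hY A - hA ⟨u, v, hu, hv, rfl⟩
  have hRc : IsClosed {p : X × Y | u p.1 = v p.2} :=
    isClosed_eq (hu.comp continuous_fst) (hv.comp continuous_snd)
  have := hRc.polishSpace
  have hw : Continuous fun p : {p : X × Y | u p.1 = v p.2} => u p.1.1 :=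
    hu.comp (continuous_fst.comp continuous_subtype_val)
  obtain ⟨𝓔, hc, hE, hs⟩ := exists_splits hw
  obtain ⟨x, y, hxy, hx⟩ : ∃ x y, u x = v y ∧ u x ∈ (⋃₀ 𝓔)ᶜ := by
    by_contra! hcon
    refine hA (potClosed_preimage_of_cover hu hv hc hE fun x y hxy => ?_)
    simpa using hcon x y hxy
  obtain ⟨H, hH, hred⟩ := hs.exists_continuous_reduction hw (r := ⟨(x, y), hxy⟩) hx
  refine ⟨fun z => (H z).1.1, fun z => (H z).1.2,
    continuous_fst.comp (continuous_subtype_val.comp hH),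
    continuous_snd.comp (continuous_subtype_val.comp hH), ?_⟩
  ext ⟨a, b⟩
  simp only [mem_preimage]
  rw [hred, ← show u (H b).1.1 = v (H b).1.2 from (H b).2]
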